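/- (Pythagorean theorem for the exponential family.) Pick any θ, θ' ∈ ℝ^m and write g = g^{(θ)}, g' = g^{(θ')}. If A g = A η (equality of all m coordinates), then d(η, g') = d(η, g) + d(g, g'). -/

import Mathlib

open Finset

attribute [local instance] Classical.propDecidable

noncomputable section

/-- The simplex `Δ_k^n`: rows are probability distributions over `Fin k`. -/
def Simplex (n k : ℕ) : Set (Fin n → Fin k → ℝ) :=
  {z | (∀ i ℓ, 0 ≤ z i ℓ) ∧ ∀ i, ∑ ℓ, z i ℓ = 1}

/-- Number of points where rule `j` does not abstain. -/
def nRule {n k p : ℕ} (h : Fin p → Fin n → Option (Fin k)) (j : Fin p) : ℕ :=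
  (Finset.univ.filter (fun i => h j i ≠ none)).card

/-- The constraint matrix `A`, with `m = p + k` rows indexed by `Fin p ⊕ Fin k`. -/
def Amat {n k p : ℕ} (h : Fin p → Fin n → Option (Fin k)) :
    Fin p ⊕ Fin k → Fin n → Fin k → ℝ
  | Sum.inl j => fun i ℓ => if h j i = some ℓ then 1 / (nRule h j : ℝ) else 0
  | Sum.inr ℓ' => fun i ℓ => if ℓ = ℓ' then 1 / (n : ℝ) else 0

/-- `(A z)_j`. -/
def applyA {n k p : ℕ} (h : Fin p → Fin n → Option (Fin k))
    (z : Fin n → Fin k → ℝ) (j : Fin p ⊕ Fin k) : ℝ :=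
  ∑ i, ∑ ℓ, Amat h j i ℓ * z i ℓ

/-- The polytope `P(b, ε)`. -/
def Polytope {n k p : ℕ} (h : Fin p → Fin n → Option (Fin k))
    (b ε : Fin p ⊕ Fin k → ℝ) : Set (Fin n → Fin k → ℝ) :=
  {z | z ∈ Simplex n k ∧ ∀ j, b j - ε j ≤ applyA h z j ∧ applyA h z j ≤ b j + ε j}

/-- Extended-real logarithm, with `elog 0 = ⊥ = -∞`. -/
def elog (x : ℝ) : EReal := if x = 0 then ⊥ else ((Real.log x : ℝ) : EReal)

/-- `z · log g`, valued in `[-∞, 0]` with the convention `0 · log 0 = 0`. -/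
def dotlog {n k : ℕ} (z g : Fin n → Fin k → ℝ) : EReal :=
  ∑ i, ∑ ℓ, (z i ℓ : EReal) * elog (g i ℓ)

/-- `a^{(θ)}_{iℓ} = Σ_j θ_j · A j i ℓ`. -/
def avec {n k p : ℕ} (h : Fin p → Fin n → Option (Fin k))
    (θ : Fin p ⊕ Fin k → ℝ) (i : Fin n) (ℓ : Fin k) : ℝ :=
  ∑ j, θ j * Amat h j i ℓ

/-- The exponential-family (softmax) prediction `g^{(θ)}`. -/
def gexp {n k p : ℕ} (h : Fin p → Fin n → Option (Fin k))
    (θ : Fin p ⊕ Fin k → ℝ) (i : Fin n) (ℓ : Fin k) : ℝ :=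
  Real.exp (avec h θ i ℓ) / ∑ ℓ', Real.exp (avec h θ i ℓ')

/-- The BF dual objective `(σ'−σ)·b − (σ'+σ)·ε − Σ_i log(Σ_ℓ exp(a^{(σ'−σ)}_{iℓ}))`. -/
def dualObj {n k p : ℕ} (h : Fin p → Fin n → Option (Fin k))
    (b ε σ σ' : Fin p ⊕ Fin k → ℝ) : ℝ :=
  (∑ j, (σ' j - σ j) * b j) - (∑ j, (σ' j + σ j) * ε j)
    - ∑ i, Real.log (∑ ℓ, Real.exp (avec h (fun j => σ' j - σ j) i ℓ))

/-- KL summand `a·log(a/c)`, with `0·log(0/c) = 0` and `a·log(a/0) = ⊤` for `a ≠ 0`. -/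
def klTerm (a c : ℝ) : EReal :=
  if a = 0 then 0 else if c = 0 then ⊤ else ((a * Real.log (a / c) : ℝ) : EReal)

/-- `d(μ, ν)`, the summed KL divergences, valued in `[0, +∞]`. -/
def dKL {n k : ℕ} (μ ν : Fin n → Fin k → ℝ) : EReal :=
  ∑ i, ∑ ℓ, klTerm (μ i ℓ) (ν i ℓ)

/-- Unnormalized one-coin Dawid–Skene score `N_{iℓ}`. -/
def Nds {n k p : ℕ} (h : Fin p → Fin n → Option (Fin k))
    (w : Fin k → ℝ) (β : Fin p → ℝ) (i : Fin n) (ℓ : Fin k) : ℝ :=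
  w ℓ * (∏ j ∈ Finset.univ.filter (fun j => h j i = some ℓ), β j)
    * ∏ j ∈ Finset.univ.filter (fun j => ∃ ℓ' ≠ ℓ, h j i = some ℓ'),
        (1 - β j) / ((k : ℝ) - 1)

/-- The one-coin Dawid–Skene prediction `g^{ds}(w, β)`. -/
def gds {n k p : ℕ} (h : Fin p → Fin n → Option (Fin k))
    (w : Fin k → ℝ) (β : Fin p → ℝ) (i : Fin n) (ℓ : Fin k) : ℝ :=
  Nds h w β i ℓ / ∑ ℓ', Nds h w β i ℓ'

lemma EReal.coe_sum {ι : Type*} (s : Finset ι) (f : ι → ℝ) :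
    ((∑ i ∈ s, f i : ℝ) : EReal) = ∑ i ∈ s, (f i : EReal) :=
  map_sum (⟨⟨Real.toEReal, EReal.coe_zero⟩, EReal.coe_add⟩ : ℝ →+ EReal) f s

lemma klTerm_of_ne_zero (a : ℝ) {c : ℝ} (hc : c ≠ 0) :
    klTerm a c = ((a * Real.log a - a * Real.log c : ℝ) : EReal) := by
  unfold klTerm
  by_cases ha : a = 0
  · simp [ha]
  · rw [if_neg ha, if_neg hc, Real.log_div ha hc, mul_sub]

lemma dKL_of_ne_zero {n k : ℕ} (μ ν : Fin n → Fin k → ℝ) (hν : ∀ i ℓ, ν i ℓ ≠ 0) :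
    dKL μ ν = ((∑ i, ∑ ℓ, μ i ℓ * Real.log (μ i ℓ)
      - ∑ i, ∑ ℓ, μ i ℓ * Real.log (ν i ℓ) : ℝ) : EReal) := by
  simp only [dKL, klTerm_of_ne_zero _ (hν _ _), ← EReal.coe_sum, Finset.sum_sub_distrib]

lemma sum_exp_avec_pos {n k p : ℕ} (hk : 0 < k) (h : Fin p → Fin n → Option (Fin k))
    (θ : Fin p ⊕ Fin k → ℝ) (i : Fin n) : 0 < ∑ ℓ, Real.exp (avec h θ i ℓ) :=
  Finset.sum_pos (fun _ _ => Real.exp_pos _) ⟨⟨0, hk⟩, Finset.mem_univ _⟩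

lemma gexp_pos {n k p : ℕ} (h : Fin p → Fin n → Option (Fin k))
    (θ : Fin p ⊕ Fin k → ℝ) (i : Fin n) (ℓ : Fin k) : 0 < gexp h θ i ℓ :=
  div_pos (Real.exp_pos _) (sum_exp_avec_pos ℓ.pos h θ i)

lemma sum_gexp {n k p : ℕ} (hk : 0 < k) (h : Fin p → Fin n → Option (Fin k))
    (θ : Fin p ⊕ Fin k → ℝ) (i : Fin n) : ∑ ℓ, gexp h θ i ℓ = 1 := by
  simp only [gexp]
  rw [← Finset.sum_div, div_self (sum_exp_avec_pos hk h θ i).ne']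

lemma log_gexp {n k p : ℕ} (h : Fin p → Fin n → Option (Fin k))
    (θ : Fin p ⊕ Fin k → ℝ) (i : Fin n) (ℓ : Fin k) :
    Real.log (gexp h θ i ℓ) = avec h θ i ℓ - Real.log (∑ ℓ', Real.exp (avec h θ i ℓ')) := by
  rw [gexp, Real.log_div (Real.exp_pos _).ne' (sum_exp_avec_pos ℓ.pos h θ i).ne', Real.log_exp]

lemma sum_mul_avec {n k p : ℕ} (h : Fin p → Fin n → Option (Fin k))
    (z : Fin n → Fin k → ℝ) (θ : Fin p ⊕ Fin k → ℝ) :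
    ∑ i, ∑ ℓ, z i ℓ * avec h θ i ℓ = ∑ j, θ j * applyA h z j := by
  simp only [avec, applyA, Finset.mul_sum]
  rw [Finset.sum_comm (s := (Finset.univ : Finset (Fin p ⊕ Fin k)))]
  refine Finset.sum_congr rfl fun i _ => ?_
  rw [Finset.sum_comm]
  refine Finset.sum_congr rfl fun j _ => Finset.sum_congr rfl fun ℓ _ => ?_
  ring

/-- The cross-entropy against an exponential-family prediction depends on `z` only through
the moments `A z`. -/
lemma sum_mul_log_gexp {n k p : ℕ} (h : Fin p → Fin n → Option (Fin k))
    (z : Fin n → Fin k → ℝ) (hz : ∀ i, ∑ ℓ, z i ℓ = 1) (θ : Fin p ⊕ Fin k → ℝ) :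
    ∑ i, ∑ ℓ, z i ℓ * Real.log (gexp h θ i ℓ) =
      ∑ j, θ j * applyA h z j - ∑ i, Real.log (∑ ℓ, Real.exp (avec h θ i ℓ)) := by
  simp only [log_gexp, mul_sub, Finset.sum_sub_distrib, ← Finset.sum_mul, hz, one_mul,
    sum_mul_avec]

/-- Pythagorean theorem for the exponential family. -/
theorem stmt4 {n k p : ℕ} (hn : 0 < n) (hk : 2 ≤ k) (hp : 0 < p)
    (h : Fin p → Fin n → Option (Fin k)) (hnj : ∀ j, 0 < nRule h j)
    (η : Fin n → Fin k → ℝ) (hη : η ∈ Simplex n k)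
    (θ θ' : Fin p ⊕ Fin k → ℝ)
    (hmatch : ∀ j, applyA h (gexp h θ) j = applyA h η j) :
    dKL η (gexp h θ') = dKL η (gexp h θ) + dKL (gexp h θ) (gexp h θ') := by
  have hrow := sum_gexp (by omega : 0 < k) h θ
  have hne := fun φ i ℓ => (gexp_pos h φ i ℓ).ne'
  rw [dKL_of_ne_zero _ _ (hne θ'), dKL_of_ne_zero _ _ (hne θ), dKL_of_ne_zero _ _ (hne θ'),
    ← EReal.coe_add]
  congr 1
  simp only [sum_mul_log_gexp h η hη.2, sum_mul_log_gexp h (gexp h θ) hrow, hmatch]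
  ring
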